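/- The satisfiability problem over expanding 2-frames with horizontal frame a finite linear order and all vertical frames difference frames is Ackermann-hard: the lossy-counter-machine reachability problem — given a counter machine M, configuration σ₀=⟨q₀,𝟎⟩ and a state q_r, does M have a lossy run starting with σ₀ and reaching q_r — which is Ackermann-hard, is computably many-one reducible to the set of bimodal formulas satisfied in some model based on such an expanding 2-frame. -/

import Mathlib

namespace HK

/-! ## Bimodal formulas -/

/-- Bimodal formulas: `φ ::= P | ¬φ | φ∧ψ | ◇₀φ | ◇₁φ`. -/
inductive BForm : Type
  | var : ℕ → BForm
  | neg : BForm → BForm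
  | and : BForm → BForm → BForm
  | dia0 : BForm → BForm
  | dia1 : BForm → BForm

namespace BForm

def imp (φ ψ : BForm) : BForm := neg (and φ (neg ψ))
def bot : BForm := and (var 0) (neg (var 0))
def top : BForm := neg bot
def box0 (φ : BForm) : BForm := neg (dia0 (neg φ))
def box1 (φ : BForm) : BForm := neg (dia1 (neg φ))
/-- `□₀⁺φ := φ ∧ □₀φ` -/
def boxP0 (φ : BForm) : BForm := and φ (box0 φ)
/-- `□₁⁺φ := φ ∧ □₁φ` -/
def boxP1 (φ : BForm) : BForm := and φ (box1 φ)

/-- Modal nesting depth. -/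
def depth : BForm → ℕ
  | var _ => 0
  | neg φ => depth φ
  | and φ ψ => max (depth φ) (depth ψ)
  | dia0 φ => depth φ + 1
  | dia1 φ => depth φ + 1

/-- The propositional variable `k` occurs in the formula. -/
def Occurs (k : ℕ) : BForm → Prop
  | var n => k = n
  | neg φ => Occurs k φ
  | and φ ψ => Occurs k φ ∨ Occurs k ψ
  | dia0 φ => Occurs k φ
  | dia1 φ => Occurs k φ

/-- The formula uses only the modal operator `◇₀`. -/
def OnlyDia0 : BForm → Prop
  | var _ => True
  | neg φ => OnlyDia0 φ
  | and φ ψ => OnlyDia0 φ ∧ OnlyDia0 ψ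
  | dia0 φ => OnlyDia0 φ
  | dia1 _ => False

/-- The formula uses only the modal operator `◇₁`. -/
def OnlyDia1 : BForm → Prop
  | var _ => True
  | neg φ => OnlyDia1 φ
  | and φ ψ => OnlyDia1 φ ∧ OnlyDia1 ψ
  | dia0 _ => False
  | dia1 φ => OnlyDia1 φ

/-- Relativisation `φ^D` of each diamond to the variable `d`:
each subformula `◇ᵢψ` is replaced by `◇ᵢ(D ∧ ψ^D)`. -/
def relativize (d : ℕ) : BForm → BForm
  | var n => var n
  | neg φ => neg (relativize d φ)
  | and φ ψ => and (relativize d φ) (relativize d ψ)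
  | dia0 φ => dia0 (and (var d) (relativize d φ))
  | dia1 φ => dia1 (and (var d) (relativize d φ))

/-- `□₀^k φ` -/
def iterBox0 : ℕ → BForm → BForm
  | 0, φ => φ
  | n+1, φ => box0 (iterBox0 n φ)

/-- `□₁^k φ` -/
def iterBox1 : ℕ → BForm → BForm
  | 0, φ => φ
  | n+1, φ => box1 (iterBox1 n φ)

/-- `□₀^{≤n} φ := ⋀_{k ≤ n} □₀^k φ` -/
def boxLe0 : ℕ → BForm → BForm
  | 0, φ => φ
  | n+1, φ => and (boxLe0 n φ) (iterBox0 (n+1) φ)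

/-- `□₁^{≤n} φ := ⋀_{k ≤ n} □₁^k φ` -/
def boxLe1 : ℕ → BForm → BForm
  | 0, φ => φ
  | n+1, φ => and (boxLe1 n φ) (iterBox1 (n+1) φ)

/-- Uniform substitution. -/
def subst (s : ℕ → BForm) : BForm → BForm
  | var n => s n
  | neg φ => neg (subst s φ)
  | and φ ψ => and (subst s φ) (subst s ψ)
  | dia0 φ => dia0 (subst s φ)
  | dia1 φ => dia1 (subst s φ)

end BForm

/-- Kripke truth over a 2-frame `⟨W, R0, R1⟩` with valuation `val`. -/
def BSat {W : Type} (R0 R1 : W → W → Prop) (val : ℕ → W → Prop) : W → BForm → Prop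
  | w, .var n => val n w
  | w, .neg φ => ¬ BSat R0 R1 val w φ
  | w, .and φ ψ => BSat R0 R1 val w φ ∧ BSat R0 R1 val w ψ
  | w, .dia0 φ => ∃ v, R0 w v ∧ BSat R0 R1 val v φ
  | w, .dia1 φ => ∃ v, R1 w v ∧ BSat R0 R1 val v φ

/-! ## Frames -/

/-- A (unimodal) frame: a nonempty set with a binary relation. -/
structure Frame : Type 1 where
  W : Type
  R : W → W → Prop
  ne : Nonempty W

/-- A 2-frame: a nonempty set with two binary relations. -/
structure Frame2 : Type 1 where
  W : Type
  R0 : W → W → Prop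
  R1 : W → W → Prop
  ne : Nonempty W

/-- Validity of a bimodal formula in a 2-frame. -/
def Frame2.Valid (F : Frame2) (φ : BForm) : Prop :=
  ∀ (val : ℕ → F.W → Prop) (w : F.W), BSat F.R0 F.R1 val w φ

/-- Satisfaction of a bimodal formula in some model based on the 2-frame. -/
def Frame2.Sat (F : Frame2) (φ : BForm) : Prop :=
  ∃ (val : ℕ → F.W → Prop) (w : F.W), BSat F.R0 F.R1 val w φ

/-- Horizontal relation of a product frame. -/
def prodR0 {A B : Type} (R : A → A → Prop) : A × B → A × B → Prop :=
  fun p q => R p.1 q.1 ∧ p.2 = q.2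

/-- Vertical relation of a product frame. -/
def prodR1 {A B : Type} (S : B → B → Prop) : A × B → A × B → Prop :=
  fun p q => p.1 = q.1 ∧ S p.2 q.2

/-- `φ` is satisfied in some model based on the product frame `⟨A,R⟩ × ⟨B,S⟩`. -/
def ProdSat {A B : Type} (R : A → A → Prop) (S : B → B → Prop) (φ : BForm) : Prop :=
  ∃ (val : ℕ → A × B → Prop) (w : A × B), BSat (prodR0 R) (prodR1 S) val w φ

/-- `φ` is valid in the product frame `⟨A,R⟩ × ⟨B,S⟩`. -/
def ProdValid {A B : Type} (R : A → A → Prop) (S : B → B → Prop) (φ : BForm) : Prop :=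
  ∀ (val : ℕ → A × B → Prop) (w : A × B), BSat (prodR0 R) (prodR1 S) val w φ

/-- The product 2-frame of two frames. -/
def prodFrame2 (A B : Type) [Nonempty A] [Nonempty B]
    (R : A → A → Prop) (S : B → B → Prop) : Frame2 :=
  ⟨A × B, prodR0 R, prodR1 S, inferInstance⟩

/-- Linear order: irreflexive, transitive and trichotomous. -/
def IsLin {T : Type} (R : T → T → Prop) : Prop :=
  (∀ x, ¬ R x x) ∧ (∀ x y z, R x y → R y z → R x z) ∧ (∀ x y, R x y ∨ x = y ∨ R y x)

/-- Weak order: transitive and weakly connected. -/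
def WeakOrd {T : Type} (R : T → T → Prop) : Prop :=
  (∀ x y z, R x y → R y z → R x z) ∧ (∀ x y z, R x y → R x z → y = z ∨ R y z ∨ R z y)

/-- Modal discreteness. -/
def ModallyDiscrete {T : Type} (R : T → T → Prop) : Prop :=
  ¬ ∃ (x : ℕ → T) (xω : T), (∀ i, R (x i) (x (i+1))) ∧ (∀ i, x i ≠ x (i+1)) ∧
      (∀ i, R (x i) xω) ∧ (∀ i, ¬ R xω (x i))

/-- No infinite ascending chains of distinct points. -/
def Noetherian {T : Type} (R : T → T → Prop) : Prop :=
  ¬ ∃ x : ℕ → T, (∀ i, R (x i) (x (i+1))) ∧ (∀ i, x i ≠ x (i+1))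

/-- The frame is (isomorphic to) `⟨ω,<⟩`. -/
def IsOmegaFrame (F : Frame) : Prop :=
  ∃ e : F.W ≃ ℕ, ∀ a b, F.R a b ↔ e a < e b

/-- The frame is a finite linear order. -/
def IsFinLinFrame (F : Frame) : Prop := Finite F.W ∧ IsLin F.R

/-- `F` contains an `⟨ω+1,>⟩`-type chain: distinct points `x₀,…,x_n,…,x_ω` with
`x_n R x_m` iff `n > m` (for `n ≠ m`). -/
def HasOmegaPlusOneChain (F : Frame) : Prop :=
  ∃ (x : ℕ → F.W) (xω : F.W), Function.Injective x ∧ (∀ n, x n ≠ xω) ∧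
    (∀ n m, n ≠ m → (F.R (x n) (x m) ↔ m < n)) ∧
    (∀ n, F.R xω (x n)) ∧ (∀ n, ¬ F.R (x n) xω)

/-! ## Two-dimensional (expanding/decreasing) 2-frames `H_{F,Ḡ}` -/

/-- A 2-frame `H_{F,Ḡ}` built from a horizontal frame `⟨H,R⟩` and, for each `x : H`,
a vertical frame `G_x = ⟨D x, S x⟩` carved out of a common ambient type `V`. -/
structure TwoFrame : Type 1 where
  H : Type
  R : H → H → Prop
  Hne : Nonempty H
  V : Type
  D : H → Set V
  S : H → V → V → Prop
  Dne : ∀ x, (D x).Nonempty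

namespace TwoFrame

/-- The horizontal frame. -/
def horiz (T : TwoFrame) : Frame := ⟨T.H, T.R, T.Hne⟩

/-- The vertical frame `G_x` at `x`. -/
def fiber (T : TwoFrame) (x : T.H) : Frame :=
  ⟨{a : T.V // a ∈ T.D x}, fun a b => T.S x a.1 b.1,
    Exists.elim (T.Dne x) (fun a ha => ⟨⟨a, ha⟩⟩)⟩

/-- The worlds `{⟨u,v⟩ : u ∈ H, v ∈ D u}`. -/
def Worlds (T : TwoFrame) : Type := {p : T.H × T.V // p.2 ∈ T.D p.1}

/-- Horizontal relation of `H_{F,Ḡ}`. -/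
def Rh (T : TwoFrame) : T.Worlds → T.Worlds → Prop :=
  fun p q => T.R p.1.1 q.1.1 ∧ p.1.2 = q.1.2

/-- Vertical relation of `H_{F,Ḡ}`. -/
def Rv (T : TwoFrame) : T.Worlds → T.Worlds → Prop :=
  fun p q => p.1.1 = q.1.1 ∧ T.S p.1.1 p.1.2 q.1.2

/-- `φ` is satisfied in some model based on `H_{F,Ḡ}`. -/
def Sat (T : TwoFrame) (φ : BForm) : Prop :=
  ∃ (val : ℕ → T.Worlds → Prop) (w : T.Worlds), BSat T.Rh T.Rv val w φ

/-- Decreasing 2-frame: `G_y` is a subframe of `G_x` whenever `x R y`. -/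
def Decreasing (T : TwoFrame) : Prop :=
  ∀ x y, T.R x y → T.D y ⊆ T.D x ∧ ∀ a ∈ T.D y, ∀ b ∈ T.D y, (T.S y a b ↔ T.S x a b)

/-- Expanding 2-frame: `G_x` is a subframe of `G_y` whenever `x R y`. -/
def Expanding (T : TwoFrame) : Prop :=
  ∀ x y, T.R x y → T.D x ⊆ T.D y ∧ ∀ a ∈ T.D x, ∀ b ∈ T.D x, (T.S x a b ↔ T.S y a b)

/-- All vertical frames are difference frames. -/
def DiffFibers (T : TwoFrame) : Prop :=
  ∀ x, ∀ a ∈ T.D x, ∀ b ∈ T.D x, (T.S x a b ↔ a ≠ b)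

end TwoFrame

/-- `φ` is satisfied in some model based on a product of a member of `C`
with a difference frame. -/
def ProdDiffSat (C : Frame → Prop) (φ : BForm) : Prop :=
  ∃ F : Frame, C F ∧ ∃ D : Type, Nonempty D ∧ ProdSat F.R (fun a b : D => a ≠ b) φ

/-- `φ` is satisfied in some model based on a decreasing 2-frame with horizontal
frame in `C` and all vertical frames difference frames. -/
def DecDiffSat (C : Frame → Prop) (φ : BForm) : Prop :=
  ∃ T : TwoFrame, C T.horiz ∧ T.Decreasing ∧ T.DiffFibers ∧ T.Sat φ

/-- `φ` is satisfied in some model based on an expanding 2-frame with horizontal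
frame in `C` and all vertical frames difference frames. -/
def ExpDiffSat (C : Frame → Prop) (φ : BForm) : Prop :=
  ∃ T : TwoFrame, C T.horiz ∧ T.Expanding ∧ T.DiffFibers ∧ T.Sat φ

/-- `φ` is satisfied in some model based on a product of a member of `C0` with a
member of `C1`. -/
def ProdClassSat (C0 C1 : Frame → Prop) (φ : BForm) : Prop :=
  ∃ F0, C0 F0 ∧ ∃ F1, C1 F1 ∧ ProdSat F0.R F1.R φ

/-- `φ` is satisfied in some model based on a decreasing 2-frame with horizontal
frame in `C0` and all vertical frames in `C1`. -/
def DecClassSat (C0 C1 : Frame → Prop) (φ : BForm) : Prop :=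
  ∃ T : TwoFrame, C0 T.horiz ∧ (∀ x, C1 (T.fiber x)) ∧ T.Decreasing ∧ T.Sat φ

/-- `φ` is satisfied in some model based on an expanding 2-frame with horizontal
frame in `C0` and all vertical frames in `C1`. -/
def ExpClassSat (C0 C1 : Frame → Prop) (φ : BForm) : Prop :=
  ∃ T : TwoFrame, C0 T.horiz ∧ (∀ x, C1 (T.fiber x)) ∧ T.Expanding ∧ T.Sat φ

/-- Satisfiability over products of `⟨ω,<⟩` with difference frames. -/
def OmegaDiffSat (φ : BForm) : Prop :=
  ∃ D : Type, Nonempty D ∧ ProdSat (fun m n : ℕ => m < n) (fun a b : D => a ≠ b) φ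

/-- Satisfiability over products of finite linear orders with difference frames. -/
def FinLinDiffSat (φ : BForm) : Prop :=
  ∃ (T : Type) (R : T → T → Prop), Finite T ∧ IsLin R ∧
    ∃ D : Type, Nonempty D ∧ ProdSat R (fun a b : D => a ≠ b) φ

/-! ## Bimodal logics -/

/-- Propositional tautology (diamond formulas treated as atoms). -/
def IsTaut (φ : BForm) : Prop :=
  ∀ v : BForm → Prop, (∀ ψ, v (BForm.neg ψ) ↔ ¬ v ψ) →
    (∀ ψ χ, v (BForm.and ψ χ) ↔ v ψ ∧ v χ) → v φ

/-- Normal bimodal logic. -/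
structure IsLogic (L : Set BForm) : Prop where
  taut : ∀ φ, IsTaut φ → φ ∈ L
  K0 : BForm.imp (BForm.box0 (BForm.imp (BForm.var 0) (BForm.var 1)))
        (BForm.imp (BForm.box0 (BForm.var 0)) (BForm.box0 (BForm.var 1))) ∈ L
  K1 : BForm.imp (BForm.box1 (BForm.imp (BForm.var 0) (BForm.var 1)))
        (BForm.imp (BForm.box1 (BForm.var 0)) (BForm.box1 (BForm.var 1))) ∈ L
  mp : ∀ φ ψ, BForm.imp φ ψ ∈ L → φ ∈ L → ψ ∈ L
  subst : ∀ φ s, φ ∈ L → BForm.subst s φ ∈ L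
  nec0 : ∀ φ, φ ∈ L → BForm.box0 φ ∈ L
  nec1 : ∀ φ, φ ∈ L → BForm.box1 φ ∈ L

/-- Validity of a (◇₀-)formula in a unimodal frame `⟨W,R⟩`. -/
def UValid0 {W : Type} (R : W → W → Prop) (φ : BForm) : Prop :=
  ∀ (val : ℕ → W → Prop) (w : W), BSat R (fun _ _ => False) val w φ

/-- Validity of a (◇₁-)formula in a unimodal frame `⟨W,S⟩`. -/
def UValid1 {W : Type} (S : W → W → Prop) (φ : BForm) : Prop :=
  ∀ (val : ℕ → W → Prop) (w : W), BSat (fun _ _ => False) S val w φ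

/-- `K4.3`: the unimodal logic (in `◇₀`) of all linear orders. -/
def K43 : Set BForm :=
  {φ | φ.OnlyDia0 ∧ ∀ (T : Type) (R : T → T → Prop), Nonempty T → IsLin R → UValid0 R φ}

/-- `Diff`: the unimodal logic (in `◇₁`) of all difference frames. -/
def DiffLogic : Set BForm :=
  {φ | φ.OnlyDia1 ∧ ∀ (D : Type), Nonempty D → UValid1 (fun a b : D => a ≠ b) φ}

/-- `Log⟨ω,<⟩`: the unimodal logic (in `◇₀`) of the frame `⟨ω,<⟩`. -/
def LogOmega : Set BForm :=
  {φ | φ.OnlyDia0 ∧ UValid0 (fun m n : ℕ => m < n) φ}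

/-- `GL.3`: the unimodal logic (in `◇₀`) of all Noetherian irreflexive linear orders. -/
def GL3 : Set BForm :=
  {φ | φ.OnlyDia0 ∧
    ∀ (T : Type) (R : T → T → Prop), Nonempty T → IsLin R → Noetherian R → UValid0 R φ}

/-- `DisK4.3`: the unimodal logic (in `◇₀`) of all modally discrete weak orders. -/
def DisK43 : Set BForm :=
  {φ | φ.OnlyDia0 ∧
    ∀ (T : Type) (R : T → T → Prop), Nonempty T → WeakOrd R → ModallyDiscrete R → UValid0 R φ}

def commAx1 : BForm :=
  BForm.imp (BForm.box1 (BForm.box0 (BForm.var 0))) (BForm.box0 (BForm.box1 (BForm.var 0)))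
def commAx2 : BForm :=
  BForm.imp (BForm.box0 (BForm.box1 (BForm.var 0))) (BForm.box1 (BForm.box0 (BForm.var 0)))
def commAx3 : BForm :=
  BForm.imp (BForm.dia0 (BForm.box1 (BForm.var 0))) (BForm.box1 (BForm.dia0 (BForm.var 0)))

/-- The commutator `[L0,L1]`: the smallest bimodal logic containing `L0`, `L1` (and
hence their fusion) together with the commutativity/confluence axioms. -/
def Commutator (L0 L1 : Set BForm) : Set BForm :=
  ⋂₀ {L : Set BForm | IsLogic L ∧ L0 ⊆ L ∧ L1 ⊆ L ∧
      commAx1 ∈ L ∧ commAx2 ∈ L ∧ commAx3 ∈ L}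

/-- The product logic `L0 × L1`: the logic of all products of a frame for `L0`
with a frame for `L1`. -/
def ProdLogic (L0 L1 : Set BForm) : Set BForm :=
  {φ | ∀ (A B : Type), Nonempty A → Nonempty B → ∀ (R : A → A → Prop) (S : B → B → Prop),
      (∀ ψ ∈ L0, UValid0 R ψ) → (∀ ψ ∈ L1, UValid1 S ψ) → ProdValid R S φ}

/-- The logic of a class of 2-frames. -/
def LogOf (C : Frame2 → Prop) : Set BForm := {φ | ∀ F, C F → F.Valid φ}

/-- Kripke completeness of a bimodal logic. -/
def KripkeComplete (L : Set BForm) : Prop := ∃ C : Frame2 → Prop, L = LogOf C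

/-- `L`-satisfiability: `φ` is satisfied in some model `M` with `M ⊨ L`. -/
def LSat (L : Set BForm) (φ : BForm) : Prop :=
  ∃ (W : Type) (_ : Nonempty W) (R0 R1 : W → W → Prop) (val : ℕ → W → Prop),
    (∀ ψ ∈ L, ∀ w, BSat R0 R1 val w ψ) ∧ ∃ w, BSat R0 R1 val w φ

/-! ## One-variable first-order temporal logic with counting (FOLTL≠) -/

/-- FOLTL≠-formulas: `φ ::= P(x) | ¬φ | φ∧ψ | ◇_F φ | ∃≠x φ`. -/
inductive TForm : Type
  | atom : ℕ → TForm
  | neg : TForm → TForm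
  | and : TForm → TForm → TForm
  | diaF : TForm → TForm
  | exNe : TForm → TForm

/-- Truth of an FOLTL≠-formula in a first-order temporal model based on the
timeline `⟨T,lt⟩` with domains `D` and interpretation `I`. -/
def TSat {T U : Type} (lt : T → T → Prop) (D : T → Set U) (I : ℕ → T → U → Prop) :
    T → U → TForm → Prop
  | t, a, .atom n => I n t a
  | t, a, .neg φ => ¬ TSat lt D I t a φ
  | t, a, .and φ ψ => TSat lt D I t a φ ∧ TSat lt D I t a ψ
  | t, a, .diaF φ => ∃ t', lt t t' ∧ a ∈ D t' ∧ TSat lt D I t' a φ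
  | t, a, .exNe φ => ∃ b, b ∈ D t ∧ b ≠ a ∧ TSat lt D I t b φ

/-- The standard translation `⋆` from FOLTL≠-formulas to bimodal formulas. -/
def TForm.star : TForm → BForm
  | .atom n => .var n
  | .neg φ => .neg (TForm.star φ)
  | .and φ ψ => .and (TForm.star φ) (TForm.star ψ)
  | .diaF φ => .dia0 (TForm.star φ)
  | .exNe φ => .dia1 (TForm.star φ)

/-- Satisfiability in constant domain models over the timeline `⟨T,lt⟩`. -/
def FOLTLConstSat {T : Type} (lt : T → T → Prop) (φ : TForm) : Prop :=
  ∃ (U : Type) (I : ℕ → T → U → Prop) (t : T) (a : U),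
    TSat lt (fun _ => (Set.univ : Set U)) I t a φ

/-- Satisfiability in decreasing domain models over the timeline `⟨T,lt⟩`. -/
def FOLTLDecSat {T : Type} (lt : T → T → Prop) (φ : TForm) : Prop :=
  ∃ (U : Type) (D : T → Set U), (∀ t, (D t).Nonempty) ∧
    (∀ t t', lt t t' → D t' ⊆ D t) ∧
    ∃ (I : ℕ → T → U → Prop) (t : T) (a : U), a ∈ D t ∧ TSat lt D I t a φ

/-- Satisfiability in expanding domain models over the timeline `⟨T,lt⟩`. -/
def FOLTLExpSat {T : Type} (lt : T → T → Prop) (φ : TForm) : Prop :=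
  ∃ (U : Type) (D : T → Set U), (∀ t, (D t).Nonempty) ∧
    (∀ t t', lt t t' → D t ⊆ D t') ∧
    ∃ (I : ℕ → T → U → Prop) (t : T) (a : U), a ∈ D t ∧ TSat lt D I t a φ

/-- Satisfiability in constant domain models over a class `C` of timelines. -/
def FOLTLConstSatC (C : Frame → Prop) (φ : TForm) : Prop :=
  ∃ F, C F ∧ FOLTLConstSat F.R φ

/-- Satisfiability in decreasing domain models over a class `C` of timelines. -/
def FOLTLDecSatC (C : Frame → Prop) (φ : TForm) : Prop :=
  ∃ F, C F ∧ FOLTLDecSat F.R φ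

/-- Satisfiability in expanding domain models over a class `C` of timelines. -/
def FOLTLExpSatC (C : Frame → Prop) (φ : TForm) : Prop :=
  ∃ F, C F ∧ FOLTLExpSat F.R φ

/-- The class of all linear orders. -/
def AllLin : Frame → Prop := fun F => IsLin F.R

/-- The class of all finite linear orders. -/
def AllFinLin : Frame → Prop := IsFinLinFrame

/-! ## Gödel numbering -/

/-- A fixed effective Gödel numbering of bimodal formulas. -/
def encodeB : BForm → ℕ
  | .var n => Nat.pair 0 n
  | .neg φ => Nat.pair 1 (encodeB φ)
  | .and φ ψ => Nat.pair 2 (Nat.pair (encodeB φ) (encodeB ψ))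
  | .dia0 φ => Nat.pair 3 (encodeB φ)
  | .dia1 φ => Nat.pair 4 (encodeB φ)

/-- A fixed effective Gödel numbering of FOLTL≠-formulas. -/
def encodeT : TForm → ℕ
  | .atom n => Nat.pair 0 n
  | .neg φ => Nat.pair 1 (encodeT φ)
  | .and φ ψ => Nat.pair 2 (Nat.pair (encodeT φ) (encodeT ψ))
  | .diaF φ => Nat.pair 3 (encodeT φ)
  | .exNe φ => Nat.pair 4 (encodeT φ)

/-- The set of codes of bimodal formulas with property `P`. -/
def BCodes (P : BForm → Prop) : ℕ → Prop := fun n => ∃ φ, encodeB φ = n ∧ P φ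

/-- The set of codes of FOLTL≠-formulas with property `P`. -/
def TCodes (P : TForm → Prop) : ℕ → Prop := fun n => ∃ φ, encodeT φ = n ∧ P φ

/-! ## The analytical hierarchy: Σ₁¹ -/

/-- `A ⊆ ℕ` is `Σ₁¹`: in normal form `n ∈ A ↔ ∃ f : ℕ → ℕ, ∀ m, R (n, f̄(m))`
for a computable predicate `R` of the number `n` and finite initial segments of `f`. -/
def Sigma11 (A : ℕ → Prop) : Prop :=
  ∃ R : ℕ × List ℕ → Prop, ComputablePred R ∧
    ∀ n, A n ↔ ∃ f : ℕ → ℕ, ∀ m, R (n, (List.range m).map f)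

/-- `Σ₁¹`-hardness with respect to computable many-one reducibility. -/
def Sigma11Hard (A : ℕ → Prop) : Prop := ∀ B : ℕ → Prop, Sigma11 B → ManyOneReducible B A

/-- `Σ₁¹`-completeness. -/
def Sigma11Complete (A : ℕ → Prop) : Prop := Sigma11 A ∧ Sigma11Hard A

/-! ## Counter (Minsky) machines -/

/-- Counter machine operations: `inl i` increments counter `i`, `inr (inl i)`
decrements counter `i`, `inr (inr i)` zero-tests counter `i`. -/
abbrev CMOp : Type := ℕ ⊕ ℕ ⊕ ℕ

def CMOp.counter : CMOp → ℕ
  | Sum.inl i => i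
  | Sum.inr (Sum.inl i) => i
  | Sum.inr (Sum.inr i) => i

/-- Description of a counter machine: number `N` of counters, number of states
(states are `0,…,states-1`), list of terminal states, and list of instructions
`(q, op, q')`. -/
abbrev CMDesc : Type := ℕ × ℕ × List ℕ × List (ℕ × CMOp × ℕ)

/-- Well-formedness of a counter machine description: `N > 1`, terminal states are
states, instructions are attached to non-terminal states and mention genuine
counters, and every non-terminal state has at least one instruction. -/
def CMWF (M : CMDesc) : Prop :=
  1 < M.1 ∧ (∀ q ∈ M.2.2.1, q < M.2.1) ∧
  (∀ t ∈ M.2.2.2, t.1 < M.2.1 ∧ t.1 ∉ M.2.2.1 ∧ t.2.2 < M.2.1 ∧ CMOp.counter t.2.1 < M.1) ∧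
  (∀ q, q < M.2.1 → q ∉ M.2.2.1 → ∃ t ∈ M.2.2.2, t.1 = q)

/-- A configuration: current state and contents of the counters. -/
abbrev CMConfig : Type := ℕ × (ℕ → ℕ)

/-- Reliable step of a counter machine. -/
def CMStep (M : CMDesc) (σ σ' : CMConfig) : Prop :=
  ∃ op q', (σ.1, op, q') ∈ M.2.2.2 ∧ σ'.1 = q' ∧
    match op with
    | Sum.inl i => σ'.2 i = σ.2 i + 1 ∧ ∀ j, j ≠ i → σ'.2 j = σ.2 j
    | Sum.inr (Sum.inl i) => 0 < σ.2 i ∧ σ'.2 i + 1 = σ.2 i ∧ ∀ j, j ≠ i → σ'.2 j = σ.2 j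
    | Sum.inr (Sum.inr i) => σ.2 i = 0 ∧ ∀ j, σ'.2 j = σ.2 j

/-- Lossy step of a counter machine. -/
def CMStepLossy (M : CMDesc) (σ σ' : CMConfig) : Prop :=
  ∃ c1 c2 : ℕ → ℕ, CMStep M (σ.1, c1) (σ'.1, c2) ∧ (∀ i, c1 i ≤ σ.2 i) ∧ (∀ i, σ'.2 i ≤ c2 i)

/-- The configuration `⟨q, 𝟎⟩` with all-0 counters. -/
def zeroConfig (q : ℕ) : CMConfig := (q, fun _ => 0)

/-- CM non-termination: the machine has an infinite run starting with `⟨q₀,𝟎⟩`. -/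
def CMNonTerm : CMDesc × ℕ → Prop := fun p =>
  CMWF p.1 ∧ ∃ ρ : ℕ → CMConfig, ρ 0 = zeroConfig p.2 ∧ ∀ n, CMStep p.1 (ρ n) (ρ (n+1))

/-- CM reachability: the machine has a run starting with `⟨q₀,𝟎⟩` reaching `q_r`. -/
def CMReach : CMDesc × ℕ × ℕ → Prop := fun p =>
  CMWF p.1 ∧ ∃ (B : ℕ) (ρ : ℕ → CMConfig), ρ 0 = zeroConfig p.2.1 ∧
    (∀ n, n < B → CMStep p.1 (ρ n) (ρ (n+1))) ∧ (ρ B).1 = p.2.2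

/-- CM recurrence: the machine has an infinite run starting with `⟨q₀,𝟎⟩`
visiting `q_r` infinitely often. -/
def CMRecur : CMDesc × ℕ × ℕ → Prop := fun p =>
  CMWF p.1 ∧ ∃ ρ : ℕ → CMConfig, ρ 0 = zeroConfig p.2.1 ∧
    (∀ n, CMStep p.1 (ρ n) (ρ (n+1))) ∧ ∀ n, ∃ m, n ≤ m ∧ (ρ m).1 = p.2.2

/-- LCM reachability: the machine has a lossy run starting with `⟨q₀,𝟎⟩`
reaching `q_r`. -/
def LCMReach : CMDesc × ℕ × ℕ → Prop := fun p =>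
  CMWF p.1 ∧ ∃ (B : ℕ) (ρ : ℕ → CMConfig), ρ 0 = zeroConfig p.2.1 ∧
    (∀ n, n < B → CMStepLossy p.1 (ρ n) (ρ (n+1))) ∧ (ρ B).1 = p.2.2

/-- LCM ω-reachability: for every `k`, the machine has a lossy run starting with
`⟨q₀,𝟎⟩` visiting `q_r` at least `k` times. -/
def LCMOmegaReach : CMDesc × ℕ × ℕ → Prop := fun p =>
  CMWF p.1 ∧ ∀ k : ℕ, ∃ (B : ℕ) (ρ : ℕ → CMConfig), ρ 0 = zeroConfig p.2.1 ∧
    (∀ n, n < B → CMStepLossy p.1 (ρ n) (ρ (n+1))) ∧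
    k ≤ ((Finset.range (B+1)).filter (fun n => (ρ n).1 = p.2.2)).card

/-! ## Particular formulas used in the statements -/

/-- `□₁⁺□₀⁺(◇₀⊤ → □₁◇₀⊤) ∧ φ` (Prop. 2.4 of the paper). -/
def diffDecForm (φ : BForm) : BForm :=
  BForm.and
    (BForm.boxP1 (BForm.boxP0
      (BForm.imp (BForm.dia0 BForm.top) (BForm.box1 (BForm.dia0 BForm.top))))) φ

/-- `D ∧ □₀^{≤n}□₁^{≤n}(◇₀D → D) ∧ φ^D`. -/
def decRelForm (d n : ℕ) (φ : BForm) : BForm :=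
  BForm.and (BForm.var d)
    (BForm.and
      (BForm.boxLe0 n (BForm.boxLe1 n
        (BForm.imp (BForm.dia0 (BForm.var d)) (BForm.var d))))
      (BForm.relativize d φ))

/-- `D ∧ □₀^{≤n}□₁^{≤n}(D → □₀D) ∧ φ^D`. -/
def expRelForm (d n : ℕ) (φ : BForm) : BForm :=
  BForm.and (BForm.var d)
    (BForm.and
      (BForm.boxLe0 n (BForm.boxLe1 n
        (BForm.imp (BForm.var d) (BForm.box0 (BForm.var d)))))
      (BForm.relativize d φ))

/-! ## The reduction: formulas -/

section Reduction

open BForm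

def fOr (φ ψ : BForm) : BForm := neg (and (neg φ) (neg ψ))
def fE (φ : BForm) : BForm := fOr φ (dia1 φ)
def fA (φ : BForm) : BForm := neg (fE (neg φ))

def bigAnd {β : Type} (l : List β) (f : β → BForm) : BForm :=
  l.foldr (fun x φ => and (f x) φ) top
def bigOr {β : Type} (l : List β) (f : β → BForm) : BForm :=
  l.foldr (fun x φ => fOr (f x) φ) bot

/-- Point markers for states and the two markers for counters. -/
def fN (q : ℕ) : BForm := var (3 * q)
def fX (i : ℕ) : BForm := var (3 * i + 1)
def fY (i : ℕ) : BForm := var (3 * i + 2)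

/-- The point currently counts towards counter `i`. -/
def fC (i : ℕ) : BForm := and (neg (dia0 (fY i))) (dia0 (fX i))
/-- The point counts towards counter `i` at the next moment. -/
def fC' (i : ℕ) : BForm := and (neg (dia0 (dia0 (fY i)))) (dia0 (dia0 (fX i)))

def fPersist (i : ℕ) : BForm := fA (imp (fC i) (fC' i))
def fGone (i : ℕ) : BForm := and (fC i) (neg (fC' i))
def fLeave (i : ℕ) : BForm := fA (imp (fGone i) (neg (dia1 (fGone i))))
def fEnter (i : ℕ) : BForm := and (fPersist i) (fE (and (neg (fC i)) (fC' i)))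
def fZero (i : ℕ) : BForm := fA (neg (fC i))
def fNext (q : ℕ) : BForm := fE (and (dia0 (fN q)) (neg (dia0 (dia0 (fN q)))))

def fG (op : CMOp) (j : ℕ) : BForm :=
  Sum.casesOn op (fun i => if i = j then fLeave j else fPersist j)
    (fun op' => Sum.casesOn op' (fun i => if i = j then fEnter j else fPersist j)
      (fun i => if i = j then fZero j else fPersist j))

def fStep (M : CMDesc) (ι : ℕ × CMOp × ℕ) : BForm :=
  and (fNext ι.1) (bigAnd (List.range M.1) (fG ι.2.1))

def fFin (M : CMDesc) (q₀ q : ℕ) : BForm :=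
  if q = q₀ then bigAnd (List.range M.1) fZero else bot

def fBody (M : CMDesc) (q₀ q : ℕ) : BForm :=
  fOr (fFin M q₀ q) (bigOr M.2.2.2 (fun ι => if ι.2.2 = q then fStep M ι else bot))

def fAll (M : CMDesc) (q₀ qr : ℕ) : BForm :=
  bigAnd (qr :: M.2.2.2.map Prod.fst) (fun q => imp (fN q) (fBody M q₀ q))

def fMain (p : CMDesc × ℕ × ℕ) : BForm :=
  and (fN p.2.2) (boxP0 (fA (fAll p.1 p.2.1 p.2.2)))

/-! ## Computability of the reduction -/

/-- A primitive recursive family of formulas. -/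
def PR {α : Type} [Primcodable α] (F : α → BForm) : Prop := Primrec (fun a => encodeB (F a))

section PR
variable {α β : Type} [Primcodable α] [Primcodable β]

theorem PR.var {f : α → ℕ} (h : Primrec f) : PR (fun a => BForm.var (f a)) :=
  Primrec₂.natPair.comp (Primrec.const 0) h
theorem PR.neg {F : α → BForm} (h : PR F) : PR (fun a => BForm.neg (F a)) :=
  Primrec₂.natPair.comp (Primrec.const 1) h
theorem PR.and {F G : α → BForm} (h : PR F) (k : PR G) : PR (fun a => BForm.and (F a) (G a)) :=
  Primrec₂.natPair.comp (Primrec.const 2) (Primrec₂.natPair.comp h k)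
theorem PR.dia0 {F : α → BForm} (h : PR F) : PR (fun a => BForm.dia0 (F a)) :=
  Primrec₂.natPair.comp (Primrec.const 3) h
theorem PR.dia1 {F : α → BForm} (h : PR F) : PR (fun a => BForm.dia1 (F a)) :=
  Primrec₂.natPair.comp (Primrec.const 4) h
theorem PR.const (φ : BForm) : PR (fun _ : α => φ) := Primrec.const _
theorem PR.fOr {F G : α → BForm} (h : PR F) (k : PR G) : PR (fun a => fOr (F a) (G a)) :=
  (h.neg.and k.neg).neg
theorem PR.imp {F G : α → BForm} (h : PR F) (k : PR G) : PR (fun a => BForm.imp (F a) (G a)) :=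
  (h.and k.neg).neg
theorem PR.fE {F : α → BForm} (h : PR F) : PR (fun a => fE (F a)) := h.fOr h.dia1
theorem PR.fA {F : α → BForm} (h : PR F) : PR (fun a => fA (F a)) := h.neg.fE.neg
theorem PR.comp {F : β → BForm} (h : PR F) {f : α → β} (hf : Primrec f) :
    PR (fun a => F (f a)) :=
  Primrec.comp (f := fun b => encodeB (F b)) h hf

theorem PR.ite {F G : α → BForm} {c : α → Prop} [DecidablePred c] (hc : PrimrecPred c)
    (h : PR F) (k : PR G) : PR (fun a => if c a then F a else G a) :=
  (Primrec.ite hc h k).of_eq (fun a => by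
    change _ = encodeB (if c a then F a else G a)
    split <;> rfl)

theorem PR.bigAnd {l : α → List β} (hl : Primrec l) {F : α → β → BForm}
    (hF : PR (fun p : α × β => F p.1 p.2)) : PR (fun a => bigAnd (l a) (F a)) := by
  have h : Primrec₂ (fun (a : α) (p : β × ℕ) =>
      Nat.pair 2 (Nat.pair (encodeB (F a p.1)) p.2)) := by
    refine Primrec₂.natPair.comp (Primrec.const 2) (Primrec₂.natPair.comp ?_
      (Primrec.snd.comp Primrec.snd))
    exact Primrec.comp (f := fun p : α × β => encodeB (F p.1 p.2)) hF
      (Primrec.fst.pair (Primrec.fst.comp Primrec.snd))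
  refine (Primrec.list_foldr hl (Primrec.const (encodeB top)) h).of_eq (fun a => ?_)
  change _ = encodeB (HK.bigAnd (l a) (F a))
  unfold HK.bigAnd
  induction l a with
  | nil => rfl
  | cons x t ih => simp only [List.foldr_cons, ih, encodeB]

theorem PR.bigOr {l : α → List β} (hl : Primrec l) {F : α → β → BForm}
    (hF : PR (fun p : α × β => F p.1 p.2)) : PR (fun a => bigOr (l a) (F a)) := by
  have h : Primrec₂ (fun (a : α) (p : β × ℕ) =>
      Nat.pair 1 (Nat.pair 2 (Nat.pair (Nat.pair 1 (encodeB (F a p.1))) (Nat.pair 1 p.2)))) := by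
    refine Primrec₂.natPair.comp (Primrec.const 1) (Primrec₂.natPair.comp (Primrec.const 2)
      (Primrec₂.natPair.comp (Primrec₂.natPair.comp (Primrec.const 1) ?_)
      (Primrec₂.natPair.comp (Primrec.const 1) (Primrec.snd.comp Primrec.snd))))
    exact Primrec.comp (f := fun p : α × β => encodeB (F p.1 p.2)) hF
      (Primrec.fst.pair (Primrec.fst.comp Primrec.snd))
  refine (Primrec.list_foldr hl (Primrec.const (encodeB bot)) h).of_eq (fun a => ?_)
  change _ = encodeB (HK.bigOr (l a) (F a))
  unfold HK.bigOr
  induction l a with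
  | nil => rfl
  | cons x t ih => simp only [List.foldr_cons, ih, encodeB, HK.fOr]

end PR

theorem pr_fN : PR fN :=
  PR.var (Primrec.nat_mul.comp (Primrec.const 3) Primrec.id)
theorem pr_fX : PR fX :=
  PR.var (Primrec.succ.comp (Primrec.nat_mul.comp (Primrec.const 3) Primrec.id))
theorem pr_fY : PR fY :=
  PR.var (Primrec.nat_add.comp (Primrec.nat_mul.comp (Primrec.const 3) Primrec.id)
    (Primrec.const 2))
theorem pr_fC : PR fC := pr_fY.dia0.neg.and pr_fX.dia0
theorem pr_fC' : PR fC' := pr_fY.dia0.dia0.neg.and pr_fX.dia0.dia0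
theorem pr_fPersist : PR fPersist := (pr_fC.imp pr_fC').fA
theorem pr_fGone : PR fGone := pr_fC.and pr_fC'.neg
theorem pr_fLeave : PR fLeave := (pr_fGone.imp pr_fGone.dia1.neg).fA
theorem pr_fEnter : PR fEnter := pr_fPersist.and (pr_fC.neg.and pr_fC').fE
theorem pr_fZero : PR fZero := pr_fC.neg.fA
theorem pr_fNext : PR fNext := (pr_fN.dia0.and pr_fN.dia0.dia0.neg).fE

theorem pr_fG : PR (fun p : CMOp × ℕ => fG p.1 p.2) := by
  have aux : ∀ {γ : Type} [Primcodable γ] (F : ℕ → BForm), PR F → ∀ (f g : γ → ℕ),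
      Primrec f → Primrec g → PR (fun c => if f c = g c then F (g c) else fPersist (g c)) := by
    intro γ _ F hF f g hf hg
    exact PR.ite (Primrec.eq.comp hf hg) (hF.comp hg) (pr_fPersist.comp hg)
  have h3 : Primrec (fun p : CMOp × ℕ => (Sum.casesOn p.1
      (fun i => encodeB (if i = p.2 then fLeave p.2 else fPersist p.2))
      (fun op' => Sum.casesOn op'
        (fun i => encodeB (if i = p.2 then fEnter p.2 else fPersist p.2))
        (fun i => encodeB (if i = p.2 then fZero p.2 else fPersist p.2))) : ℕ)) := by
    refine Primrec.sumCasesOn Primrec.fst ?_ ?_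
    · exact aux fLeave pr_fLeave (fun x : (CMOp × ℕ) × ℕ => x.2) (fun x => x.1.2) Primrec.snd
        (Primrec.snd.comp Primrec.fst)
    · refine Primrec.sumCasesOn (α := (CMOp × ℕ) × (ℕ ⊕ ℕ)) Primrec.snd ?_ ?_
      · exact aux fEnter pr_fEnter (fun x : ((CMOp × ℕ) × (ℕ ⊕ ℕ)) × ℕ => x.2)
          (fun x => x.1.1.2) Primrec.snd
          (Primrec.snd.comp (Primrec.fst.comp Primrec.fst))
      · exact aux fZero pr_fZero (fun x : ((CMOp × ℕ) × (ℕ ⊕ ℕ)) × ℕ => x.2)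
          (fun x => x.1.1.2) Primrec.snd
          (Primrec.snd.comp (Primrec.fst.comp Primrec.fst))
  refine h3.of_eq (fun p => ?_)
  obtain ⟨op, j⟩ := p
  rcases op with i | i | i <;> rfl

theorem pr_fStep {α : Type} [Primcodable α] {n q : α → ℕ} {op : α → CMOp} (hn : Primrec n)
    (hq : Primrec q) (hop : Primrec op) :
    PR (fun a => and (fNext (q a)) (bigAnd (List.range (n a)) (fG (op a)))) := by
  have h3 : PR (fun x : α × ℕ => fG (op x.1) x.2) :=
    PR.comp pr_fG (Primrec.pair (hop.comp Primrec.fst) Primrec.snd)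
  exact PR.and (pr_fNext.comp hq) (PR.bigAnd (Primrec.list_range.comp hn) h3)

theorem pr_fBody {α : Type} [Primcodable α] {n q q₀ : α → ℕ} {I : α → List (ℕ × CMOp × ℕ)}
    (hn : Primrec n) (hq : Primrec q) (hq₀ : Primrec q₀) (hI : Primrec I) :
    PR (fun a => fOr (if q a = q₀ a then bigAnd (List.range (n a)) fZero else bot)
      (bigOr (I a) (fun ι => if ι.2.2 = q a then
        (and (fNext ι.1) (bigAnd (List.range (n a)) (fG ι.2.1))) else bot))) := by
  have e4 : Primrec (fun x : α × (ℕ × CMOp × ℕ) => x.2.2.2) :=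
    Primrec.snd.comp (Primrec.snd.comp Primrec.snd)
  have e5 : Primrec (fun x : α × (ℕ × CMOp × ℕ) => x.2.2.1) :=
    Primrec.fst.comp (Primrec.snd.comp Primrec.snd)
  have e6 : Primrec (fun x : α × (ℕ × CMOp × ℕ) => x.2.1) :=
    Primrec.fst.comp Primrec.snd
  refine PR.fOr ?_ ?_
  · refine PR.ite (Primrec.eq.comp hq hq₀) ?_ (PR.const _)
    exact PR.bigAnd (F := fun (_ : α) j => fZero j) (Primrec.list_range.comp hn)
      (pr_fZero.comp Primrec.snd)
  · refine PR.bigOr hI ?_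
    exact PR.ite (Primrec.eq.comp e4 (hq.comp Primrec.fst))
      (pr_fStep (hn.comp Primrec.fst) e6 e5) (PR.const bot)

theorem pr_fMain_aux {α : Type} [Primcodable α] {n qr q₀ : α → ℕ}
    {I : α → List (ℕ × CMOp × ℕ)}
    (hn : Primrec n) (hqr : Primrec qr) (hq₀ : Primrec q₀) (hI : Primrec I) :
    PR (fun a => and (fN (qr a)) (boxP0 (fA (bigAnd (qr a :: (I a).map Prod.fst) (fun q =>
      imp (fN q) (fOr (if q = q₀ a then bigAnd (List.range (n a)) fZero else bot)
      (bigOr (I a) (fun ι => if ι.2.2 = q then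
        (and (fNext ι.1) (bigAnd (List.range (n a)) (fG ι.2.1))) else bot)))))))) := by
  have e3 : Primrec (fun a => qr a :: (I a).map Prod.fst) :=
    Primrec.list_cons.comp hqr (Primrec.list_map hI
      (Primrec.to₂ (Primrec.fst.comp Primrec.snd)))
  have hA : PR (fun a => fA (bigAnd (qr a :: (I a).map Prod.fst) (fun q =>
      imp (fN q) (fOr (if q = q₀ a then bigAnd (List.range (n a)) fZero else bot)
      (bigOr (I a) (fun ι => if ι.2.2 = q then
        (and (fNext ι.1) (bigAnd (List.range (n a)) (fG ι.2.1))) else bot)))))) := by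
    refine PR.fA (PR.bigAnd e3 (PR.imp (pr_fN.comp Primrec.snd) ?_))
    exact pr_fBody (hn.comp Primrec.fst) Primrec.snd (hq₀.comp Primrec.fst)
      (hI.comp Primrec.fst)
  exact PR.and (pr_fN.comp hqr) (hA.and hA.neg.dia0.neg)

theorem pr_fMain : PR fMain :=
  pr_fMain_aux (α := CMDesc × ℕ × ℕ) (n := fun p => p.1.1) (qr := fun p => p.2.2)
    (q₀ := fun p => p.2.1) (I := fun p => p.1.2.2.2)
    (Primrec.fst.comp Primrec.fst) (Primrec.snd.comp Primrec.snd) (Primrec.fst.comp Primrec.snd)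
    (Primrec.snd.comp (Primrec.snd.comp (Primrec.snd.comp Primrec.fst)))

theorem primrecPred_CMWF : PrimrecPred CMWF := by
  have memR : PrimrecRel (fun (q : ℕ) (l : List ℕ) => q ∈ l) :=
    PrimrecRel.of_eq (PrimrecRel.swap (PrimrecRel.exists_mem_list
      (R := fun a b : ℕ => a = b) Primrec.eq)) (fun a l => by simp [Function.swap])
  have hop : Primrec CMOp.counter := by
    have : Primrec (fun op : CMOp => (Sum.casesOn op (fun i => i)
        (fun o => Sum.casesOn o (fun i => i) (fun i => i)) : ℕ)) :=
      Primrec.sumCasesOn Primrec.id Primrec.snd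
        (Primrec.sumCasesOn (α := CMOp × (ℕ ⊕ ℕ)) Primrec.snd Primrec.snd Primrec.snd)
    refine this.of_eq (fun op => ?_)
    rcases op with i | i | i <;> rfl
  have h2 : PrimrecPred (fun M : CMDesc => ∀ q ∈ M.2.2.1, q < M.2.1) :=
    (PrimrecRel.forall_mem_list (R := fun (q : ℕ) (M : CMDesc) => q < M.2.1)
      (Primrec.nat_lt.comp Primrec.fst (Primrec.fst.comp (Primrec.snd.comp Primrec.snd)))).comp
      (Primrec.fst.comp (Primrec.snd.comp Primrec.snd)) Primrec.id
  have h3 : PrimrecPred (fun M : CMDesc => ∀ t ∈ M.2.2.2, t.1 < M.2.1 ∧ t.1 ∉ M.2.2.1 ∧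
      t.2.2 < M.2.1 ∧ CMOp.counter t.2.1 < M.1) := by
    refine (PrimrecRel.forall_mem_list (R := fun (t : ℕ × CMOp × ℕ) (M : CMDesc) =>
      t.1 < M.2.1 ∧ t.1 ∉ M.2.2.1 ∧ t.2.2 < M.2.1 ∧ CMOp.counter t.2.1 < M.1) ?_).comp
      (Primrec.snd.comp (Primrec.snd.comp Primrec.snd)) Primrec.id
    have s1 : Primrec (fun x : (ℕ × CMOp × ℕ) × CMDesc => x.2.2.1) :=
      Primrec.fst.comp (Primrec.snd.comp Primrec.snd)
    refine PrimrecPred.and (Primrec.nat_lt.comp (Primrec.fst.comp Primrec.fst) s1)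
      (PrimrecPred.and (PrimrecPred.not (memR.comp (Primrec.fst.comp Primrec.fst)
        (Primrec.fst.comp (Primrec.snd.comp (Primrec.snd.comp Primrec.snd)))))
      (PrimrecPred.and (Primrec.nat_lt.comp
        (Primrec.snd.comp (Primrec.snd.comp Primrec.fst)) s1)
        (Primrec.nat_lt.comp (hop.comp (Primrec.fst.comp (Primrec.snd.comp Primrec.fst)))
          (Primrec.fst.comp Primrec.snd))))
  have h4 : PrimrecPred (fun M : CMDesc => ∀ q ∈ List.range M.2.1, q ∈ M.2.2.1 ∨
      ∃ t ∈ M.2.2.2, t.1 = q) := by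
    refine (PrimrecRel.forall_mem_list (R := fun (q : ℕ) (M : CMDesc) => q ∈ M.2.2.1 ∨
      ∃ t ∈ M.2.2.2, t.1 = q) ?_).comp
      (Primrec.list_range.comp (Primrec.fst.comp Primrec.snd)) Primrec.id
    refine PrimrecPred.or (memR.comp Primrec.fst
        (Primrec.fst.comp (Primrec.snd.comp (Primrec.snd.comp Primrec.snd)))) ?_
    exact (PrimrecRel.exists_mem_list (R := fun (t : ℕ × CMOp × ℕ) (q : ℕ) => t.1 = q)
      (Primrec.eq.comp (Primrec.fst.comp Primrec.fst) Primrec.snd)).comp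
      (Primrec.snd.comp (Primrec.snd.comp (Primrec.snd.comp Primrec.snd))) Primrec.fst
  refine ((Primrec.nat_lt.comp (Primrec.const 1) Primrec.fst).and (h2.and (h3.and h4))).of_eq ?_
  intro M
  unfold CMWF
  refine and_congr Iff.rfl (and_congr Iff.rfl (and_congr Iff.rfl ?_))
  simp only [List.mem_range]
  exact forall_congr' fun q => imp_congr_right fun _ => or_iff_not_imp_left

theorem encodeB_inj : ∀ φ ψ : BForm, encodeB φ = encodeB ψ → φ = ψ := by
  intro φ
  induction φ with
  | var n => intro ψ h; cases ψ <;> simp_all [encodeB, Nat.pair_eq_pair]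
  | neg φ ih =>
    intro ψ h
    cases ψ <;> simp only [encodeB, Nat.pair_eq_pair] at h <;> simp at h
    rw [ih _ h]
  | and φ φ' ih ih' =>
    intro ψ h
    cases ψ <;> simp only [encodeB, Nat.pair_eq_pair] at h <;> simp at h
    rw [ih _ h.1, ih' _ h.2]
  | dia0 φ ih =>
    intro ψ h
    cases ψ <;> simp only [encodeB, Nat.pair_eq_pair] at h <;> simp at h
    rw [ih _ h]
  | dia1 φ ih =>
    intro ψ h
    cases ψ <;> simp only [encodeB, Nat.pair_eq_pair] at h <;> simp at h
    rw [ih _ h]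

/-! ## Lossy steps as inequalities -/

/-- The relation between the new value `a` and the old value `b` of counter `j` in a lossy
step performing `op`. -/
def stepCond (op : CMOp) (j a b : ℕ) : Prop :=
  match op with
  | Sum.inl i => if i = j then a ≤ b + 1 else a ≤ b
  | Sum.inr (Sum.inl i) => if i = j then a + 1 ≤ b else a ≤ b
  | Sum.inr (Sum.inr i) => if i = j then a = 0 else a ≤ b

theorem lossy_iff (M : CMDesc) (σ σ' : CMConfig) :
    CMStepLossy M σ σ' ↔
      ∃ op, (σ.1, op, σ'.1) ∈ M.2.2.2 ∧ ∀ j, stepCond op j (σ'.2 j) (σ.2 j) := by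
  constructor
  · rintro ⟨c1, c2, ⟨op, q', hmem, hq, hop⟩, h1, h2⟩
    simp only at hmem hq hop
    refine ⟨op, hq ▸ hmem, fun j => ?_⟩
    have a1 := h1 j
    have a2 := h2 j
    rcases op with i | i | i <;> simp only [stepCond] at hop ⊢ <;> split_ifs with hij
    · subst hij; omega
    · have := hop.2 j (Ne.symm hij); omega
    · subst hij; omega
    · have := hop.2.2 j (Ne.symm hij); omega
    · subst hij; have := hop.2 i; omega
    · have := hop.2 j; omega
  · rintro ⟨op, hmem, hop⟩
    rcases op with i | i | i
    · refine ⟨σ.2, Function.update σ.2 i (σ.2 i + 1), ⟨_, _, hmem, rfl, ?_⟩, fun _ => le_rfl, ?_⟩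
      · refine ⟨by simp, fun j hj => by simp [hj]⟩
      · intro j
        have := hop j
        simp only [stepCond] at this
        by_cases hij : i = j
        · subst hij; simpa using this
        · rw [if_neg hij] at this
          simpa [Function.update_of_ne (Ne.symm hij)] using this
    · have hi := hop i
      simp only [stepCond, if_true] at hi
      refine ⟨σ.2, Function.update σ.2 i (σ.2 i - 1), ⟨_, _, hmem, rfl, ?_⟩, fun _ => le_rfl, ?_⟩
      · refine ⟨by simp only; omega, by simp; omega, fun j hj => by simp [hj]⟩
      · intro j
        have := hop j
        simp only [stepCond] at this
        by_cases hij : i = j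
        · subst hij; simp; omega
        · rw [if_neg hij] at this
          simpa [Function.update_of_ne (Ne.symm hij)] using this
    · refine ⟨Function.update σ.2 i 0, Function.update σ.2 i 0, ⟨_, _, hmem, rfl, ?_⟩, ?_, ?_⟩
      · exact ⟨by simp, fun _ => rfl⟩
      · intro j
        by_cases hij : j = i
        · subst hij; simp
        · simp [hij]
      · intro j
        have := hop j
        simp only [stepCond] at this
        by_cases hij : i = j
        · subst hij; simpa using this
        · rw [if_neg hij] at this
          simpa [Function.update_of_ne (Ne.symm hij)] using this

theorem run_of_reach {M : CMDesc} {σ σ' : CMConfig}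
    (h : Relation.ReflTransGen (CMStepLossy M) σ σ') :
    ∃ (B : ℕ) (ρ : ℕ → CMConfig), ρ 0 = σ ∧
      (∀ n, n < B → CMStepLossy M (ρ n) (ρ (n+1))) ∧ ρ B = σ' := by
  induction h with
  | refl => exact ⟨0, fun _ => σ, rfl, by simp, rfl⟩
  | @tail b c _ hbc ih =>
    obtain ⟨B, ρ, h0, hs, hB⟩ := ih
    refine ⟨B + 1, fun n => if n ≤ B then ρ n else c, by simpa using h0, ?_, by simp⟩
    intro n hn
    rcases Nat.lt_or_ge n B with h | h
    · simpa [h.le, Nat.succ_le_of_lt h] using hs n h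
    · have : n = B := by omega
      subst this
      simpa [hB] using hbc

/-! ## Semantics -/

section Sem

variable {W : Type} {R0 R1 : W → W → Prop} {val : ℕ → W → Prop}

theorem sat_bigAnd {β : Type} (l : List β) (f : β → BForm) (w : W) :
    BSat R0 R1 val w (bigAnd l f) ↔ ∀ x ∈ l, BSat R0 R1 val w (f x) := by
  induction l with
  | nil => simp [bigAnd, top, bot, BSat]
  | cons x t ih =>
    rw [List.forall_mem_cons, ← ih]; rfl

theorem sat_or (φ ψ : BForm) (w : W) :
    BSat R0 R1 val w (fOr φ ψ) ↔ BSat R0 R1 val w φ ∨ BSat R0 R1 val w ψ := by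
  simp only [fOr, BSat]; tauto

theorem sat_imp (φ ψ : BForm) (w : W) :
    BSat R0 R1 val w (imp φ ψ) ↔ (BSat R0 R1 val w φ → BSat R0 R1 val w ψ) := by
  simp only [imp, BSat]; tauto

theorem sat_bot (w : W) : ¬ BSat R0 R1 val w bot := by
  simp [bot, BSat]

theorem sat_bigOr {β : Type} (l : List β) (f : β → BForm) (w : W) :
    BSat R0 R1 val w (bigOr l f) ↔ ∃ x ∈ l, BSat R0 R1 val w (f x) := by
  induction l with
  | nil => simp [bigOr, bot, BSat]
  | cons x t ih =>
    refine (sat_or _ _ _).trans ?_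
    change BSat R0 R1 val w (f x) ∨ BSat R0 R1 val w (bigOr t f) ↔ _
    rw [ih]; simp

theorem sat_box0 (φ : BForm) (w : W) :
    BSat R0 R1 val w (boxP0 φ) ↔
      BSat R0 R1 val w φ ∧ ∀ v, R0 w v → BSat R0 R1 val v φ := by
  simp only [boxP0, box0, BSat]; simp

end Sem

section Sem2

variable {T : TwoFrame} {val : ℕ → T.Worlds → Prop}

/-- The points of column `t` where `φ` holds. -/
def colSet (T : TwoFrame) (val : ℕ → T.Worlds → Prop) (φ : BForm) (t : T.H) : Set T.V :=
  {v | ∃ h : v ∈ T.D t, BSat T.Rh T.Rv val ⟨(t, v), h⟩ φ}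

theorem mem_colSet (φ : BForm) (t : T.H) (v : T.V) (h : v ∈ T.D t) :
    v ∈ colSet T val φ t ↔ BSat T.Rh T.Rv val ⟨(t, v), h⟩ φ :=
  ⟨fun ⟨_, h'⟩ => h', fun h' => ⟨h, h'⟩⟩

theorem sat_dia0 (_ : T.Expanding) (φ : BForm) (t : T.H) (v : T.V) (h : v ∈ T.D t) :
    BSat T.Rh T.Rv val ⟨(t, v), h⟩ (dia0 φ) ↔ ∃ s, T.R t s ∧ v ∈ colSet T val φ s := by
  constructor
  · rintro ⟨⟨⟨s, v'⟩, hs⟩, ⟨hR, hv⟩, hφ⟩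
    simp only at hv hR
    subst hv
    exact ⟨s, hR, hs, hφ⟩
  · rintro ⟨s, hR, hs, hφ⟩
    exact ⟨⟨(s, v), hs⟩, ⟨hR, rfl⟩, hφ⟩

theorem sat_dia1 (hD : T.DiffFibers) (φ : BForm) (t : T.H) (v : T.V) (h : v ∈ T.D t) :
    BSat T.Rh T.Rv val ⟨(t, v), h⟩ (dia1 φ) ↔ ∃ u, v ≠ u ∧ u ∈ colSet T val φ t := by
  constructor
  · rintro ⟨⟨⟨s, v'⟩, hs⟩, ⟨hR, hv⟩, hφ⟩
    simp only at hv hR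
    subst hR
    exact ⟨v', (hD t v h v' hs).1 hv, hs, hφ⟩
  · rintro ⟨u, hne, hu, hφ⟩
    exact ⟨⟨(t, u), hu⟩, ⟨rfl, (hD t v h u hu).2 hne⟩, hφ⟩

theorem sat_E (hD : T.DiffFibers) (φ : BForm) (t : T.H) (v : T.V) (h : v ∈ T.D t) :
    BSat T.Rh T.Rv val ⟨(t, v), h⟩ (fE φ) ↔ ∃ u, u ∈ colSet T val φ t := by
  refine (sat_or _ _ _).trans ?_
  rw [sat_dia1 hD, ← mem_colSet]
  constructor
  · rintro (h | ⟨u, -, h⟩)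
    exacts [⟨v, h⟩, ⟨u, h⟩]
  · rintro ⟨u, hu⟩
    by_cases huv : v = u
    · subst huv; exact Or.inl hu
    · exact Or.inr ⟨u, huv, hu⟩

theorem sat_A (hD : T.DiffFibers) (φ : BForm) (t : T.H) (v : T.V) (h : v ∈ T.D t) :
    BSat T.Rh T.Rv val ⟨(t, v), h⟩ (fA φ) ↔
      ∀ u (hu : u ∈ T.D t), BSat T.Rh T.Rv val ⟨(t, u), hu⟩ φ := by
  have : BSat T.Rh T.Rv val ⟨(t, v), h⟩ (fA φ) ↔
    ¬ BSat T.Rh T.Rv val ⟨(t, v), h⟩ (fE (neg φ)) := Iff.rfl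
  rw [this, sat_E hD]
  simp [colSet, BSat]

/-- `s` is the immediate successor of `t`. -/
def Cov (T : TwoFrame) (t s : T.H) : Prop := T.R t s ∧ ∀ a, T.R t a → a = s ∨ T.R s a

theorem sat_dia00 (hE : T.Expanding) (hL : IsLin T.R) {t s : T.H} (hc : Cov T t s) (φ : BForm)
    (v : T.V) (h : v ∈ T.D t) :
    BSat T.Rh T.Rv val ⟨(t, v), h⟩ (dia0 (dia0 φ)) ↔ v ∈ colSet T val (dia0 φ) s := by
  have hs : v ∈ T.D s := (hE t s hc.1).1 h
  rw [sat_dia0 hE, mem_colSet _ _ _ hs, sat_dia0 hE]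
  constructor
  · rintro ⟨a, ha, ha', hφ⟩
    rw [sat_dia0 hE] at hφ
    obtain ⟨b, hb, hb'⟩ := hφ
    rcases hc.2 a ha with rfl | h1
    · exact ⟨b, hb, hb'⟩
    · exact ⟨b, hL.2.1 _ _ _ h1 hb, hb'⟩
  · rintro ⟨b, hb, hb'⟩
    exact ⟨s, hc.1, hs, (sat_dia0 hE _ _ _ _).2 ⟨b, hb, hb'⟩⟩

theorem sat_C' (hE : T.Expanding) (hL : IsLin T.R) {t s : T.H} (hc : Cov T t s) (i : ℕ)
    (v : T.V) (h : v ∈ T.D t) :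
    BSat T.Rh T.Rv val ⟨(t, v), h⟩ (fC' i) ↔ v ∈ colSet T val (fC i) s := by
  have hs : v ∈ T.D s := (hE t s hc.1).1 h
  have e : ∀ φ, BSat T.Rh T.Rv val ⟨(t, v), h⟩ (dia0 (dia0 φ)) ↔
      BSat T.Rh T.Rv val ⟨(s, v), hs⟩ (dia0 φ) := fun φ => by
    rw [sat_dia00 hE hL hc, mem_colSet]
  rw [mem_colSet _ _ _ hs]
  exact and_congr (not_congr (e _)) (e _)

/-- Semantic content of `fG`. -/
def setCond {V : Type} (op : CMOp) (j : ℕ) (D A B : Set V) : Prop :=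
  match op with
  | Sum.inl i => if i = j then (∀ x ∈ A, x ∉ B → ∀ y ∈ A, y ∉ B → x = y) else A ⊆ B
  | Sum.inr (Sum.inl i) => if i = j then A ⊆ B ∧ ∃ x ∈ D, x ∉ A ∧ x ∈ B else A ⊆ B
  | Sum.inr (Sum.inr i) => if i = j then A = ∅ else A ⊆ B

theorem sat_zero (hD : T.DiffFibers) (j : ℕ) (t : T.H) (v : T.V) (h : v ∈ T.D t) :
    BSat T.Rh T.Rv val ⟨(t, v), h⟩ (fZero j) ↔ colSet T val (fC j) t = ∅ := by
  rw [fZero, sat_A hD, Set.eq_empty_iff_forall_notMem]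
  exact ⟨fun H u ⟨hu, hu'⟩ => H u hu hu', fun H u hu hu' => H u ⟨hu, hu'⟩⟩

theorem sat_G (hD : T.DiffFibers) (hE : T.Expanding) (hL : IsLin T.R) {t s : T.H}
    (hc : Cov T t s) (op : CMOp) (j : ℕ) (v : T.V) (h : v ∈ T.D t) :
    BSat T.Rh T.Rv val ⟨(t, v), h⟩ (fG op j) ↔
      setCond op j (T.D t) (colSet T val (fC j) t) (colSet T val (fC j) s) := by
  have hP : BSat T.Rh T.Rv val ⟨(t, v), h⟩ (fPersist j) ↔
      colSet T val (fC j) t ⊆ colSet T val (fC j) s := by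
    rw [fPersist, sat_A hD]
    constructor
    · rintro H u ⟨hu, hu'⟩
      exact (sat_C' hE hL hc _ _ _).1 ((sat_imp _ _ _).1 (H u hu) hu')
    · intro H u hu
      exact (sat_imp _ _ _).2 fun hu' => (sat_C' hE hL hc _ _ _).2 (H ⟨hu, hu'⟩)
  have hgone : ∀ u, u ∈ colSet T val (fGone j) t ↔
      u ∈ colSet T val (fC j) t ∧ u ∉ colSet T val (fC j) s := by
    intro u
    constructor
    · rintro ⟨hu, h1, h2⟩
      refine ⟨⟨hu, h1⟩, fun h3 => h2 ?_⟩
      exact (sat_C' hE hL hc _ _ _).2 h3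
    · rintro ⟨⟨hu, h1⟩, h2⟩
      exact ⟨hu, h1, fun h3 => h2 ((sat_C' hE hL hc _ _ _).1 h3)⟩
  have hLv : BSat T.Rh T.Rv val ⟨(t, v), h⟩ (fLeave j) ↔
      (∀ x ∈ colSet T val (fC j) t, x ∉ colSet T val (fC j) s →
        ∀ y ∈ colSet T val (fC j) t, y ∉ colSet T val (fC j) s → x = y) := by
    rw [fLeave, sat_A hD]
    constructor
    · intro H x hx hx' y hy hy'
      by_contra hne
      obtain ⟨hxD, hxg⟩ := (hgone x).2 ⟨hx, hx'⟩
      have := (sat_imp _ _ _).1 (H x hxD) hxg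
      exact this ((sat_dia1 hD _ _ _ _).2 ⟨y, hne, (hgone y).2 ⟨hy, hy'⟩⟩)
    · intro H x hx
      refine (sat_imp _ _ _).2 fun hg hd => ?_
      obtain ⟨y, hne, hy⟩ := (sat_dia1 hD _ _ _ _).1 hd
      have h1 := (hgone x).1 ⟨hx, hg⟩
      have h2 := (hgone y).1 hy
      exact hne (H x h1.1 h1.2 y h2.1 h2.2)
  have hEn : BSat T.Rh T.Rv val ⟨(t, v), h⟩ (fEnter j) ↔
      colSet T val (fC j) t ⊆ colSet T val (fC j) s ∧
      ∃ x ∈ T.D t, x ∉ colSet T val (fC j) t ∧ x ∈ colSet T val (fC j) s := by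
    refine and_congr hP ?_
    rw [sat_E hD]
    refine exists_congr fun x => ?_
    constructor
    · rintro ⟨hx, h1, h2⟩
      exact ⟨hx, fun ⟨_, h3⟩ => h1 h3, (sat_C' hE hL hc _ _ _).1 h2⟩
    · rintro ⟨hx, h1, h2⟩
      exact ⟨hx, fun h3 => h1 ⟨hx, h3⟩, (sat_C' hE hL hc _ _ _).2 h2⟩
  rcases op with i | i | i <;> simp only [fG, setCond] <;> split_ifs
  exacts [hLv, hP, hEn, hP, sat_zero hD _ _ _ _, hP]

theorem setCond_stepCond {V : Type} {op : CMOp} {j : ℕ} {D A B : Set V} {b : ℕ}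
    (h : setCond op j D A B) (hb : B.encard ≤ b) :
    ∃ a : ℕ, A.encard ≤ a ∧ stepCond op j a b := by
  have hsub : A ⊆ B → A.encard ≤ b := fun h => (Set.encard_le_encard h).trans hb
  rcases op with i | i | i <;> simp only [setCond, stepCond] at h ⊢ <;> split_ifs at h ⊢
  · refine ⟨b + 1, ?_, le_rfl⟩
    have h1 : A ⊆ B ∪ (A \ B) := by intro x hx; by_cases x ∈ B <;> simp_all
    have h2 : (A \ B).encard ≤ 1 := by
      rw [Set.encard_le_one_iff]
      intro x y hx hy
      exact h x hx.1 hx.2 y hy.1 hy.2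
    calc A.encard ≤ (B ∪ (A \ B)).encard := Set.encard_le_encard h1
      _ ≤ B.encard + (A \ B).encard := Set.encard_union_le _ _
      _ ≤ b + 1 := add_le_add hb h2
      _ = ((b + 1 : ℕ) : ℕ∞) := by push_cast; rfl
  · exact ⟨b, hsub h, le_rfl⟩
  · obtain ⟨h1, x, -, hx, hx'⟩ := h
    have h2 : A.encard + 1 ≤ b := by
      rw [← Set.encard_insert_of_notMem hx]
      exact (Set.encard_le_encard (Set.insert_subset hx' h1)).trans hb
    have h3 : A.encard ≠ ⊤ := by
      intro h4; rw [h4] at h2; simp at h2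
    obtain ⟨a, ha⟩ := ENat.ne_top_iff_exists.1 h3
    rw [← ha] at h2 ⊢
    exact ⟨a, le_rfl, by exact_mod_cast h2⟩
  · exact ⟨b, hsub h, le_rfl⟩
  · exact ⟨0, by simp [h], rfl⟩
  · exact ⟨b, hsub h, le_rfl⟩

theorem exists_cov (hF : Finite T.H) (hL : IsLin T.R) {t a : T.H} (h : T.R t a) :
    ∃ s, Cov T t s := by
  have : IsStrictOrder T.H T.R := { irrefl := hL.1, trans := hL.2.1 }
  have wf : WellFounded T.R := Finite.wellFounded_of_trans_of_irrefl T.R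
  obtain ⟨s, hs, hmin⟩ := wf.has_min {s | T.R t s} ⟨a, h⟩
  refine ⟨s, hs, fun b hb => ?_⟩
  rcases hL.2.2 b s with h1 | h1 | h1
  · exact absurd h1 (hmin b hb)
  · exact Or.inl h1
  · exact Or.inr h1

theorem soundness (hF : Finite T.H) (hL : IsLin T.R) (hD : T.DiffFibers) (hE : T.Expanding)
    (M : CMDesc) (hM : CMWF M) (q₀ qr : ℕ) (t₀ : T.H)
    (H : ∀ t, (t = t₀ ∨ T.R t₀ t) → ∀ v (hv : v ∈ T.D t),
      BSat T.Rh T.Rv val ⟨(t, v), hv⟩ (fAll M q₀ qr)) :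
    ∀ t, (t = t₀ ∨ T.R t₀ t) → ∀ v (hv : v ∈ T.D t) q,
      (q = qr ∨ ∃ ι ∈ M.2.2.2, ι.1 = q) → BSat T.Rh T.Rv val ⟨(t, v), hv⟩ (fN q) →
      ∃ c : ℕ → ℕ, Relation.ReflTransGen (CMStepLossy M) (zeroConfig q₀) (q, c) ∧
        ∀ i < M.1, (colSet T val (fC i) t).encard ≤ c i := by
  have : IsStrictOrder T.H (Function.swap T.R) :=
    { irrefl := hL.1, trans := fun a b c h1 h2 => hL.2.1 _ _ _ h2 h1 }
  have wf : WellFounded (Function.swap T.R) := Finite.wellFounded_of_trans_of_irrefl _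
  intro t
  induction t using wf.induction with
  | _ t ih =>
  intro ht v hv q hq hN
  have h1 := (sat_bigAnd _ _ _).1 (H t ht v hv) q (by
    rcases hq with rfl | ⟨ι, h, rfl⟩
    · simp
    · exact List.mem_cons_of_mem _ (List.mem_map_of_mem h))
  have h2 := (sat_imp _ _ _).1 h1 hN
  rcases (sat_or _ _ _).1 h2 with h3 | h3
  · unfold fFin at h3
    split_ifs at h3 with hqq
    · subst hqq
      refine ⟨fun _ => 0, Relation.ReflTransGen.refl, fun i hi => ?_⟩
      have := (sat_bigAnd _ _ _).1 h3 i (by simpa using hi)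
      rw [sat_zero hD] at this
      simp [this]
    · exact absurd h3 (sat_bot _)
  · obtain ⟨ι, hι, h4⟩ := (sat_bigOr _ _ _).1 h3
    split_ifs at h4 with htgt
    swap
    · exact absurd h4 (sat_bot _)
    obtain ⟨h5, h6⟩ := h4
    obtain ⟨u, hu, h7, h8⟩ := (sat_E hD _ _ _ _).1 h5
    obtain ⟨a, hta, hua⟩ := (sat_dia0 hE _ _ _ _).1 h7
    obtain ⟨s, hc⟩ := exists_cov hF hL hta
    have hus : u ∈ T.D s := (hE t s hc.1).1 hu
    have has : a = s := by
      rcases hc.2 a hta with h | h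
      · exact h
      · exfalso
        refine h8 ((sat_dia00 hE hL hc _ _ _).2 ⟨hus, ?_⟩)
        exact (sat_dia0 hE _ _ _ _).2 ⟨a, h, hua⟩
    subst has
    have hta' : a = t₀ ∨ T.R t₀ a := by
      rcases ht with rfl | ht
      · exact Or.inr hta
      · exact Or.inr (hL.2.1 _ _ _ ht hta)
    obtain ⟨c, hreach, hcnt⟩ := ih a hta hta' u hus ι.1 (Or.inr ⟨ι, hι, rfl⟩) hua.2
    have key : ∀ j, ∃ x : ℕ, (j < M.1 → (colSet T val (fC j) t).encard ≤ x) ∧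
        stepCond ι.2.1 j x (c j) := by
      intro j
      by_cases hj : j < M.1
      · have h9 := (sat_bigAnd _ _ _).1 h6 j (by simpa using hj)
        obtain ⟨x, hx, hx'⟩ := setCond_stepCond ((sat_G hD hE hL hc _ _ _ _).1 h9) (hcnt j hj)
        exact ⟨x, fun _ => hx, hx'⟩
      · refine ⟨0, fun h => absurd h hj, ?_⟩
        have hcn := (hM.2.2.1 ι hι).2.2.2
        rcases hop : ι.2.1 with i | i | i <;> rw [hop] at hcn <;>
          simp only [CMOp.counter] at hcn <;> simp only [stepCond] <;>
          rw [if_neg (by omega)] <;> exact Nat.zero_le _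
    choose c' hc1 hc2 using key
    refine ⟨c', hreach.tail ?_, fun i hi => hc1 i hi⟩
    rw [lossy_iff]
    refine ⟨ι.2.1, ?_, hc2⟩
    subst htgt
    exact hι

end Sem2

theorem sat_to_reach (p : CMDesc × ℕ × ℕ) (hM : CMWF p.1)
    (h : ExpDiffSat IsFinLinFrame (fMain p)) : LCMReach p := by
  obtain ⟨T, ⟨hF, hL⟩, hE, hD, val, ⟨⟨t₀, v₀⟩, hv₀⟩, hN, hB⟩ := h
  replace hB := (sat_box0 _ _).1 hB
  have H : ∀ t, (t = t₀ ∨ T.R t₀ t) → ∀ v (hv : v ∈ T.D t),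
      BSat T.Rh T.Rv val ⟨(t, v), hv⟩ (fAll p.1 p.2.1 p.2.2) := by
    rintro t (rfl | ht) v hv
    · exact (sat_A hD _ _ _ _).1 hB.1 v hv
    · have h0 : v₀ ∈ T.D t := (hE _ _ ht).1 hv₀
      exact (sat_A hD _ _ _ h0).1 (hB.2 ⟨(t, v₀), h0⟩ ⟨ht, rfl⟩) v hv
  obtain ⟨c, hr, -⟩ := soundness hF hL hD hE p.1 hM p.2.1 p.2.2 t₀ H t₀ (Or.inl rfl) v₀ hv₀ p.2.2
    (Or.inl rfl) hN
  obtain ⟨B, ρ, h0, hs, hB⟩ := run_of_reach hr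
  exact ⟨hM, B, ρ, h0, hs, by rw [hB]⟩

/-! ## From runs to models -/

/-- The grid with `B + 2` columns and constant vertical difference frames on `ℕ`. -/
def gridT (B : ℕ) : TwoFrame where
  H := Fin (B + 2)
  R := fun a b => a < b
  Hne := ⟨0⟩
  V := ℕ
  D := fun _ => Set.univ
  S := fun _ a b => a ≠ b
  Dne := fun _ => ⟨0, trivial⟩

theorem gridT_fin (B : ℕ) : Finite (gridT B).H := inferInstanceAs (Finite (Fin (B + 2)))

theorem gridT_lin (B : ℕ) : IsLin (gridT B).R :=
  ⟨fun x => lt_irrefl (α := Fin (B + 2)) x,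
   fun _ _ _ h1 h2 => lt_trans (α := Fin (B + 2)) h1 h2,
   fun x y => lt_trichotomy (α := Fin (B + 2)) x y⟩

theorem gridT_exp (B : ℕ) : (gridT B).Expanding :=
  fun _ _ _ => ⟨fun _ _ => trivial, fun _ _ _ _ => Iff.rfl⟩

theorem gridT_diff (B : ℕ) : (gridT B).DiffFibers :=
  fun _ _ _ _ _ => Iff.rfl

/-- Number of points that have entered the counter up to column `k`. -/
def cIn (c : ℕ → ℕ) : ℕ → ℕ
  | 0 => c 0
  | k + 1 => cIn c k + (c (k + 1) - c k)
/-- Number of points that have left the counter up to column `k`. -/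
def cOut (c : ℕ → ℕ) : ℕ → ℕ
  | 0 => 0
  | k + 1 => cOut c k + (c k - c (k + 1))

theorem cIn_eq (c : ℕ → ℕ) (k : ℕ) : cIn c k = cOut c k + c k := by
  induction k with
  | zero => simp [cIn, cOut]
  | succ k ih => simp only [cIn, cOut]; omega

theorem cIn_mono (c : ℕ → ℕ) : Monotone (cIn c) :=
  monotone_nat_of_le_succ fun _ => Nat.le_add_right _ _
theorem cOut_mono (c : ℕ → ℕ) : Monotone (cOut c) :=
  monotone_nat_of_le_succ fun _ => Nat.le_add_right _ _

def gridVal (B : ℕ) (st : ℕ → ℕ) (c : ℕ → ℕ → ℕ) (n : ℕ) (w : (gridT B).Worlds) : Prop :=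
  let k : ℕ := Fin.val (n := B + 2) w.1.1
  let v : ℕ := w.1.2
  (n % 3 = 0 ∧ k ≤ B ∧ n / 3 = st k ∧ v = k) ∨
  (n % 3 = 1 ∧ cOut (c (n / 3)) (k - 1) ≤ v) ∨
  (n % 3 = 2 ∧ cIn (c (n / 3)) (k - 1) ≤ v)

section Grid
variable {B : ℕ} {st : ℕ → ℕ} {c : ℕ → ℕ → ℕ}

theorem grid_N (q : ℕ) (k : Fin (B + 2)) (v : ℕ) :
    v ∈ colSet (gridT B) (gridVal B st c) (fN q) k ↔ k.1 ≤ B ∧ q = st k.1 ∧ v = k.1 := by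
  refine (mem_colSet (T := gridT B) (fN q) k v trivial).trans ?_
  change gridVal B st c (3 * q) _ ↔ _
  simp only [gridVal]
  have e : 3 * q / 3 = q := by omega
  rw [e]
  constructor
  · rintro (h | h | h)
    · exact h.2
    · omega
    · omega
  · intro h
    exact Or.inl ⟨by omega, h⟩

theorem grid_X (i : ℕ) (k : Fin (B + 2)) (v : ℕ) :
    v ∈ colSet (gridT B) (gridVal B st c) (fX i) k ↔ cOut (c i) (k.1 - 1) ≤ v := by
  refine (mem_colSet (T := gridT B) (fX i) k v trivial).trans ?_
  change gridVal B st c (3 * i + 1) _ ↔ _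
  simp only [gridVal]
  have e : (3 * i + 1) / 3 = i := by omega
  rw [e]
  constructor
  · rintro (h | h | h)
    · omega
    · exact h.2
    · omega
  · intro h
    exact Or.inr (Or.inl ⟨by omega, h⟩)

theorem grid_Y (i : ℕ) (k : Fin (B + 2)) (v : ℕ) :
    v ∈ colSet (gridT B) (gridVal B st c) (fY i) k ↔ cIn (c i) (k.1 - 1) ≤ v := by
  refine (mem_colSet (T := gridT B) (fY i) k v trivial).trans ?_
  change gridVal B st c (3 * i + 2) _ ↔ _
  simp only [gridVal]
  have e : (3 * i + 2) / 3 = i := by omega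
  rw [e]
  constructor
  · rintro (h | h | h)
    · omega
    · omega
    · exact h.2
  · intro h
    exact Or.inr (Or.inr ⟨by omega, h⟩)

theorem grid_dia (φ : BForm) (f : ℕ → ℕ) (hf : Monotone f)
    (hφ : ∀ (k : Fin (B + 2)) (v : ℕ),
      v ∈ colSet (gridT B) (gridVal B st c) φ k ↔ f (k.1 - 1) ≤ v)
    (k : Fin (B + 2)) (hk : k.1 ≤ B) (v : ℕ) :
    BSat (gridT B).Rh (gridT B).Rv (gridVal B st c) ⟨(k, v), trivial⟩ (dia0 φ) ↔ f k.1 ≤ v := by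
  refine (sat_dia0 (gridT_exp B) φ k v trivial).trans ?_
  constructor
  · rintro ⟨s, hs, h⟩
    have h' := (hφ s v).1 h
    have hs' : k.1 < Fin.val (n := B + 2) s := hs
    exact (hf (by omega)).trans h'
  · intro h
    refine ⟨(⟨k.1 + 1, by omega⟩ : Fin (B + 2)), ?_, (hφ _ v).2 (by simpa using h)⟩
    exact Nat.lt_succ_self k.1

theorem grid_C (i : ℕ) (k : Fin (B + 2)) (hk : k.1 ≤ B) :
    colSet (gridT B) (gridVal B st c) (fC i) k =
      {v : ℕ | cOut (c i) k.1 ≤ v ∧ v < cIn (c i) k.1} := by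
  ext v
  refine (mem_colSet (T := gridT B) (fC i) k v trivial).trans ?_
  refine (and_congr (not_congr (grid_dia (fY i) _ (cIn_mono (c i)) (grid_Y i) k hk v))
    (grid_dia (fX i) _ (cOut_mono (c i)) (grid_X i) k hk v)).trans ?_
  exact ⟨fun h => ⟨h.2, Nat.lt_of_not_le h.1⟩, fun h => ⟨Nat.not_le_of_lt h.2, h.1⟩⟩

theorem setCond_queue (op : CMOp) (j : ℕ) (c : ℕ → ℕ) (k : ℕ)
    (h : stepCond op j (c k) (c (k + 1))) :
    setCond op j (Set.univ : Set ℕ) {v : ℕ | cOut c k ≤ v ∧ v < cIn c k}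
      {v : ℕ | cOut c (k + 1) ≤ v ∧ v < cIn c (k + 1)} := by
  have e1 := cIn_eq c k
  have hO : cOut c (k + 1) = cOut c k + (c k - c (k + 1)) := rfl
  have hI : cIn c (k + 1) = cIn c k + (c (k + 1) - c k) := rfl
  have hsub : c k ≤ c (k + 1) → {v : ℕ | cOut c k ≤ v ∧ v < cIn c k} ⊆
      {v : ℕ | cOut c (k + 1) ≤ v ∧ v < cIn c (k + 1)} := by
    intro hle v hv
    simp only [Set.mem_ofPred_eq] at hv ⊢
    omega
  rcases op with i | i | i <;> simp only [setCond, stepCond] at h ⊢ <;> split_ifs at h ⊢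
  · intro x hx hx' y hy hy'
    simp only [Set.mem_ofPred_eq] at hx hx' hy hy'
    omega
  · exact hsub h
  · refine ⟨hsub (by omega), cIn c k, trivial, ?_, ?_⟩
    · simp
    · simp only [Set.mem_ofPred_eq]
      omega
  · exact hsub h
  · ext v
    simp only [Set.mem_ofPred_eq, Set.mem_empty_iff_false, iff_false]
    omega
  · exact hsub h

end Grid

theorem reach_to_sat (p : CMDesc × ℕ × ℕ) (h : LCMReach p) :
    ExpDiffSat IsFinLinFrame (fMain p) := by
  obtain ⟨M, q₀, qr⟩ := p
  obtain ⟨hM, B, ρ, h0, hs, hB⟩ := h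
  simp only at hM h0 hs hB
  set st : ℕ → ℕ := fun k => (ρ (B - k)).1 with hst
  set c : ℕ → ℕ → ℕ := fun i k => (ρ (B - k)).2 i with hc
  have hall : ∀ (k : Fin (B + 2)) (v : ℕ),
      BSat (gridT B).Rh (gridT B).Rv (gridVal B st c) ⟨(k, v), trivial⟩ (fAll M q₀ qr) := by
    intro k v
    refine (sat_bigAnd _ _ _).2 fun q _ => (sat_imp _ _ _).2 fun hN => ?_
    obtain ⟨hk, hq, hv⟩ := (grid_N q k v).1 ⟨trivial, hN⟩
    refine (sat_or _ _ _).2 ?_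
    rcases Nat.lt_or_ge k.1 B with hlt | hge
    · right
      have hstep := hs (B - (k.1 + 1)) (by omega)
      have e : B - (k.1 + 1) + 1 = B - k.1 := by omega
      rw [e] at hstep
      obtain ⟨op, hmem, hcond⟩ := (lossy_iff _ _ _).1 hstep
      refine (sat_bigOr _ _ _).2 ⟨_, hmem, ?_⟩
      rw [if_pos (by simp only [hq, hst])]
      let s : Fin (B + 2) := ⟨k.1 + 1, by omega⟩
      have hcov : Cov (gridT B) k s := by
        refine ⟨Nat.lt_succ_self k.1, fun a ha => ?_⟩
        have ha' : k.1 < Fin.val (n := B + 2) a := ha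
        rcases Nat.lt_or_ge (k.1 + 1) (Fin.val (n := B + 2) a) with h | h
        · exact Or.inr h
        · exact Or.inl (Fin.ext (n := B + 2) (by change Fin.val (n := B + 2) a = k.1 + 1; omega))
      refine ⟨?_, ?_⟩
      · refine (sat_E (gridT_diff B) _ _ _ _).2 ⟨(k.1 + 1 : ℕ), trivial, ?_, ?_⟩
        · refine (sat_dia0 (gridT_exp B) _ _ _ _).2 ⟨s, hcov.1, ?_⟩
          exact (grid_N _ s _).2 ⟨hlt, rfl, rfl⟩
        · intro hbad
          obtain ⟨_, hbad⟩ := (sat_dia00 (gridT_exp B) (gridT_lin B) hcov _ _ _).1 hbad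
          obtain ⟨a, ha, hNa⟩ := (sat_dia0 (gridT_exp B) _ _ _ _).1 hbad
          have h1 := ((grid_N _ a _).1 hNa).2.2
          have h2 : k.1 + 1 < Fin.val (n := B + 2) a := ha
          omega
      · refine (sat_bigAnd _ _ _).2 fun j _ => ?_
        refine (sat_G (gridT_diff B) (gridT_exp B) (gridT_lin B) hcov _ _ _ _).2 ?_
        rw [grid_C j k hk, grid_C j s hlt]
        exact setCond_queue op j (c j) k.1 (hcond j)
    · left
      have hkB : k.1 = B := by omega
      have hq0 : q = q₀ := by
        rw [hq, hst, hkB]; simp [h0, zeroConfig]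
      unfold fFin
      rw [if_pos hq0]
      refine (sat_bigAnd _ _ _).2 fun j _ => ?_
      refine (sat_zero (gridT_diff B) _ _ _ _).2 ?_
      rw [grid_C j k hk]
      have e1 := cIn_eq (c j) k.1
      have e2 : c j k.1 = 0 := by rw [hc, hkB]; simp [h0, zeroConfig]
      have e3 : ({v : ℕ | cOut (c j) k.1 ≤ v ∧ v < cIn (c j) k.1} : Set ℕ) = ∅ := by
        refine Set.eq_empty_iff_forall_notMem.2 fun v hv => ?_
        have hv1 : cOut (c j) k.1 ≤ v ∧ v < cIn (c j) k.1 := hv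
        omega
      exact e3
  refine ⟨gridT B, ⟨gridT_fin B, gridT_lin B⟩, gridT_exp B, gridT_diff B, gridVal B st c,
    ⟨((0 : Fin (B + 2)), (0 : ℕ)), trivial⟩, ?_, ?_⟩
  · exact ((grid_N qr (0 : Fin (B + 2)) 0).2 ⟨Nat.zero_le _, by simp [hst, hB], rfl⟩).2
  · refine (sat_box0 _ _).2 ⟨?_, ?_⟩
    · exact (sat_A (gridT_diff B) _ _ _ _).2 fun u _ => hall _ u
    · rintro ⟨⟨k, v⟩, hv⟩ _
      exact (sat_A (gridT_diff B) _ _ _ _).2 fun u _ => hall k u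

end Reduction

/-- Satisfiability over expanding 2-frames with horizontal frame a
finite linear order and all vertical frames difference frames is Ackermann-hard:
the (Ackermann-hard) lossy counter-machine reachability problem is computably
many-one reducible to it. -/
theorem finlin_expanding_diff_Ackermann_hard :
    ManyOneReducible LCMReach (BCodes (ExpDiffSat IsFinLinFrame)) := by
  classical
  have hbot : ¬ ExpDiffSat IsFinLinFrame BForm.bot := by
    rintro ⟨T, -, -, -, val, w, h⟩
    exact sat_bot w h
  refine ⟨fun p => encodeB (if CMWF p.1 then fMain p else BForm.bot), ?_, fun p => ?_⟩
  · exact Primrec.to_comp (PR.ite (primrecPred_CMWF.comp Primrec.fst) pr_fMain (PR.const _))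
  · by_cases hM : CMWF p.1
    · simp only [if_pos hM]
      constructor
      · exact fun h => ⟨_, rfl, reach_to_sat p h⟩
      · rintro ⟨φ, h1, h2⟩
        rw [encodeB_inj _ _ h1] at h2
        exact sat_to_reach p hM h2
    · simp only [if_neg hM]
      constructor
      · exact fun h => absurd h.1 hM
      · rintro ⟨φ, h1, h2⟩
        rw [encodeB_inj _ _ h1] at h2
        exact absurd h2 hbot

end HK
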